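/- arXiv:2301.04996 — 2 statements merged into one kernel-verified Lean document; each statement's English description precedes it below -/
import Mathlib

section
/- Lower bound (Jensen): Let b ∈ (0,1)^m, f = h ∘ g with h : ℝ → ℝ convex nonnegative and g = Σ_{J ∈ {0,...,m}^n} a_J ℓ_J with a_J ≥ 0 for all J ≠ (0,...,0), where ℓ_J(ω^1,...,ω^n) = Π_k ℓ_{j_k}(ω^k), ℓ_0 ≡ 1 and ℓ_i the i-th coordinate. Then for every (L,b)-stable positive-a.e. density p on Ω^n and every 0 ≤ k ≤ n, E_p(f | L^1,...,L^k)(ω^1,...,ω^k) ≥ f(ω^1,...,ω^k, b,...,b) a.e. -/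
open MeasureTheory

/-- Marginal density over the coordinate set `S` for densities on `Ω^n`,
`Ω = [0,1]^m`. -/
noncomputable def margC (n m : ℕ) (p : (Fin n → Fin m → ℝ) → ℝ)
    (S : Finset (Fin n)) (x : Fin n → Fin m → ℝ) : ℝ :=
  ∫ τ : {i : Fin n // i ∉ S} → (Fin m → ℝ),
    p (fun i => if h : i ∈ S then x i else τ ⟨i, h⟩)
    ∂(Measure.pi fun _ : {i : Fin n // i ∉ S} =>
        volume.restrict (Set.Icc (0 : Fin m → ℝ) 1))

/-- Conditional expectation `E_p(f | (L^i)_{i ∈ S} = (x_i)_{i ∈ S})`. -/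
noncomputable def condC (n m : ℕ) (p f : (Fin n → Fin m → ℝ) → ℝ)
    (S : Finset (Fin n)) (x : Fin n → Fin m → ℝ) : ℝ :=
  ∫ τ : {i : Fin n // i ∉ S} → (Fin m → ℝ),
    f (fun i => if h : i ∈ S then x i else τ ⟨i, h⟩) *
      (p (fun i => if h : i ∈ S then x i else τ ⟨i, h⟩) / margC n m p S x)
    ∂(Measure.pi fun _ : {i : Fin n // i ∉ S} =>
        volume.restrict (Set.Icc (0 : Fin m → ℝ) 1))

/-- `(L,b)`-stability. -/
def LbStable (n m : ℕ) (b : Fin m → ℝ) (p : (Fin n → Fin m → ℝ) → ℝ) : Prop :=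
  ∀ k : Fin n,
    ∀ᵐ x ∂(Measure.pi fun _ : Fin n =>
        volume.restrict (Set.Icc (0 : Fin m → ℝ) 1)),
      ∀ j : Fin m, condC n m p (fun y => y k j) (Finset.Iio k) x = b j

/-- The coordinate functions `ℓ_0 ≡ 1`, `ℓ_i(ω) = ω_i` (`1 ≤ i ≤ m`). -/
noncomputable def ell (m : ℕ) (j : Fin (m + 1)) (ω : Fin m → ℝ) : ℝ :=
  if h : (j : ℕ) = 0 then 1 else ω ⟨(j : ℕ) - 1, by have := j.isLt; omega⟩

section ProductMeasure

variable {ι X : Type*} [Fintype ι] [DecidableEq ι] [MeasurableSpace X]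
  (μ : Measure X) [IsProbabilityMeasure μ]

/-- The integral of `f` over the coordinates outside `S`, the coordinates in `S` being those
of `x`. -/
noncomputable def fiberIntegral (S : Finset ι) (f : (ι → X) → ℝ) (x : ι → X) : ℝ :=
  ∫ y, f (S.piecewise x y) ∂(Measure.pi fun _ : ι => μ)

theorem measurable_piecewise_prod {ι X : Type*} [DecidableEq ι] [MeasurableSpace X] (S : Finset ι) :
    Measurable fun z : (ι → X) × (ι → X) => S.piecewise z.1 z.2 := by
  refine measurable_pi_lambda _ fun i => ?_
  by_cases hi : i ∈ S
  · simpa [hi] using measurable_fst.eval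
  · simpa [hi] using measurable_snd.eval

theorem measurePreserving_piecewise (S : Finset ι) :
    MeasurePreserving (fun z : (ι → X) × (ι → X) => S.piecewise z.1 z.2)
      ((Measure.pi fun _ : ι => μ).prod (Measure.pi fun _ : ι => μ))
      (Measure.pi fun _ : ι => μ) := by
  refine ⟨measurable_piecewise_prod S, (Measure.pi_eq fun s hs => ?_).symm⟩
  rw [Measure.map_apply (measurable_piecewise_prod S) (MeasurableSet.univ_pi hs)]
  have hpre : (fun z : (ι → X) × (ι → X) => S.piecewise z.1 z.2) ⁻¹' (Set.univ.pi s) =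
      (Set.univ.pi fun i => if i ∈ S then s i else Set.univ) ×ˢ
        (Set.univ.pi fun i => if i ∈ S then Set.univ else s i) := by
    ext z
    simp only [Set.mem_preimage, Set.mem_pi, Set.mem_univ, true_implies, Set.mem_prod,
      ← forall_and]
    refine forall_congr' fun i => ?_
    by_cases hi : i ∈ S <;> simp [hi]
  rw [hpre, Measure.prod_prod, Measure.pi_pi, Measure.pi_pi, ← Finset.prod_mul_distrib]
  refine Finset.prod_congr rfl fun i _ => ?_
  by_cases hi : i ∈ S <;> simp [hi]

theorem ae_ae_piecewise (S : Finset ι) {Q : (ι → X) → Prop}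
    (hQ : ∀ᵐ y ∂(Measure.pi fun _ : ι => μ), Q y) :
    ∀ᵐ x ∂(Measure.pi fun _ : ι => μ), ∀ᵐ y ∂(Measure.pi fun _ : ι => μ),
      Q (S.piecewise x y) :=
  Measure.ae_ae_of_ae_prod ((measurePreserving_piecewise μ S).quasiMeasurePreserving.ae hQ)

variable {μ}

theorem fiberIntegral_congr_ae (S : Finset ι) {f g : (ι → X) → ℝ}
    (hfg : f =ᵐ[Measure.pi fun _ : ι => μ] g) :
    fiberIntegral μ S f =ᵐ[Measure.pi fun _ : ι => μ] fiberIntegral μ S g := by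
  filter_upwards [ae_ae_piecewise μ S hfg] with x hx
  exact integral_congr_ae hx

theorem integrable_comp_piecewise (S : Finset ι) {f : (ι → X) → ℝ}
    (hf : Integrable f (Measure.pi fun _ : ι => μ)) :
    ∀ᵐ x ∂(Measure.pi fun _ : ι => μ),
      Integrable (fun y => f (S.piecewise x y)) (Measure.pi fun _ : ι => μ) :=
  ((measurePreserving_piecewise μ S).integrable_comp_of_integrable hf).prod_right_ae

theorem fiberIntegral_fiberIntegral {S T : Finset ι} (hST : S ⊆ T) {f : (ι → X) → ℝ}
    (hf : Integrable f (Measure.pi fun _ : ι => μ)) :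
    fiberIntegral μ S (fiberIntegral μ T f) =ᵐ[Measure.pi fun _ : ι => μ]
      fiberIntegral μ S f := by
  filter_upwards [integrable_comp_piecewise S hf] with x hx
  have hT := measurePreserving_piecewise μ T
  have hx' := hT.integrable_comp_of_integrable hx
  have hpw : ∀ y z : ι → X,
      T.piecewise (S.piecewise x y) z = S.piecewise x (T.piecewise y z) := by
    intro y z
    ext i
    by_cases hS : i ∈ S
    · simp [hS, hST hS]
    · by_cases hi : i ∈ T <;> simp [hS, hi]
  calc fiberIntegral μ S (fiberIntegral μ T f) x
      = ∫ y, ∫ z, f (S.piecewise x (T.piecewise y z)) ∂(Measure.pi fun _ : ι => μ)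
          ∂(Measure.pi fun _ : ι => μ) := by simp only [fiberIntegral, hpw]
    _ = ∫ w, f (S.piecewise x (T.piecewise w.1 w.2))
          ∂((Measure.pi fun _ : ι => μ).prod (Measure.pi fun _ : ι => μ)) :=
        (integral_prod _ hx').symm
    _ = fiberIntegral μ S f x := by
        have hmap := integral_map hT.aemeasurable (f := fun y => f (S.piecewise x y))
          (by rw [hT.map_eq]; exact hx.aestronglyMeasurable)
        rw [hT.map_eq] at hmap
        exact hmap.symm

theorem fiberIntegral_mul_left {ι X : Type*} [Fintype ι] [DecidableEq ι] [MeasurableSpace X]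
    {μ : Measure X} (S : Finset ι) {φ : (ι → X) → ℝ}
    (hφ : ∀ x y, φ (S.piecewise x y) = φ x) (f : (ι → X) → ℝ) (x : ι → X) :
    fiberIntegral μ S (fun y => φ y * f y) x = φ x * fiberIntegral μ S f x := by
  simp only [fiberIntegral, hφ, integral_const_mul]

theorem fiberIntegral_pos (S : Finset ι) {p : (ι → X) → ℝ}
    (hp : Integrable p (Measure.pi fun _ : ι => μ))
    (hpos : ∀ᵐ y ∂(Measure.pi fun _ : ι => μ), 0 < p y) :
    ∀ᵐ x ∂(Measure.pi fun _ : ι => μ), 0 < fiberIntegral μ S p x := by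
  filter_upwards [ae_ae_piecewise μ S hpos, integrable_comp_piecewise S hp] with x hx hint
  rw [fiberIntegral, integral_pos_iff_support_of_nonneg_ae (hx.mono fun y hy => hy.le) hint]
  have hsupp : Function.support (fun y => p (S.piecewise x y))
      =ᵐ[Measure.pi fun _ : ι => μ] Set.univ :=
    Filter.eventuallyEq_univ.2 (hx.mono fun y hy => hy.ne')
  rw [measure_congr hsupp]
  simp

theorem integral_pi_compl_eq (S : Finset ι) {f : (ι → X) → ℝ} (hf : Measurable f) (x : ι → X) :
    ∫ τ : {i : ι // i ∉ S} → X, f (fun i => if h : i ∈ S then x i else τ ⟨i, h⟩)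
      ∂(Measure.pi fun _ : {i : ι // i ∉ S} => μ) = fiberIntegral μ S f x := by
  have hrestrict : MeasurePreserving (fun (y : ι → X) (i : {i : ι // i ∉ S}) => y i)
      (Measure.pi fun _ : ι => μ) (Measure.pi fun _ : {i : ι // i ∉ S} => μ) :=
    measurePreserving_fst.comp (measurePreserving_piEquivPiSubtypeProd (fun _ : ι => μ) (· ∉ S))
  rw [← hrestrict.map_eq, integral_map hrestrict.aemeasurable]
  · refine integral_congr_ae (.of_forall fun y => congrArg f ?_)
    ext i
    by_cases hi : i ∈ S <;> simp [hi]
  · refine (hf.comp (measurable_pi_lambda _ fun i => ?_)).aestronglyMeasurable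
    by_cases hi : i ∈ S
    · simp [hi]
    · simpa [hi] using measurable_pi_apply _

end ProductMeasure

theorem ConvexOn.exists_affine_le {h : ℝ → ℝ} (hconv : ConvexOn ℝ Set.univ h) (s : ℝ) :
    ∃ c : ℝ, ∀ t, h s + c * (t - s) ≤ h t := by
  have hs : ∀ t : ℝ, t ∈ interior (Set.univ : Set ℝ) := by simp
  refine ⟨derivWithin h (Set.Ioi s) s, fun t => ?_⟩
  rcases lt_trichotomy s t with hst | rfl | hts
  · have hslope := hconv.rightDeriv_le_slope_of_mem_interior (hs s) (Set.mem_univ t) hst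
    rw [slope_def_field, le_div_iff₀ (sub_pos.2 hst)] at hslope
    linarith
  · simp
  · have hslope := (hconv.slope_le_leftDeriv_of_mem_interior (Set.mem_univ t) (hs s) hts).trans
      (hconv.leftDeriv_le_rightDeriv_of_mem_interior (hs s))
    rw [slope_def_field, div_le_iff₀ (sub_pos.2 hts)] at hslope
    linarith

section Cube

/-- Lebesgue measure on the unit cube `[0,1]^m`. -/
local notation "cubeMeasure" m:max => Measure.restrict volume (Set.Icc (0 : Fin m → ℝ) 1)

instance isProbabilityMeasure_cube (m : ℕ) : IsProbabilityMeasure (cubeMeasure m) :=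
  ⟨by simp [Real.volume_Icc_pi]⟩

theorem continuous_ell (m : ℕ) (j : Fin (m + 1)) : Continuous (ell m j) := by
  by_cases hj : (j : ℕ) = 0
  · have hell : ell m j = fun _ => 1 := by ext ω; simp [ell, hj]
    exact hell ▸ continuous_const
  · have hell : ell m j = fun ω => ω ⟨(j : ℕ) - 1, by have := j.isLt; omega⟩ := by
      ext ω; simp [ell, hj]
    exact hell ▸ continuous_apply _

variable {n m : ℕ}

theorem integrable_continuous_mul {φ q : (Fin n → Fin m → ℝ) → ℝ} (hφ : Continuous φ)
    (hq : Integrable q (Measure.pi fun _ : Fin n => cubeMeasure m)) :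
    Integrable (fun y => φ y * q y) (Measure.pi fun _ : Fin n => cubeMeasure m) := by
  obtain ⟨C, hC⟩ := (isCompact_Icc (a := (0 : Fin n → Fin m → ℝ))
    (b := 1)).exists_bound_of_continuousOn hφ.continuousOn
  refine hq.bdd_mul (c := C) hφ.aestronglyMeasurable ?_
  have hmem : ∀ i : Fin n, ∀ᵐ y ∂(Measure.pi fun _ : Fin n => cubeMeasure m),
      y i ∈ Set.Icc (0 : Fin m → ℝ) 1 := fun i =>
    (measurePreserving_eval (fun _ : Fin n => cubeMeasure m) i).quasiMeasurePreserving.ae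
      (ae_restrict_mem measurableSet_Icc)
  filter_upwards [ae_all_iff.2 hmem] with y hy
  exact hC y ⟨fun i => (hy i).1, fun i => (hy i).2⟩

theorem margC_eq_fiberIntegral {p : (Fin n → Fin m → ℝ) → ℝ} (hp : Measurable p)
    (S : Finset (Fin n)) (x : Fin n → Fin m → ℝ) :
    margC n m p S x = fiberIntegral (cubeMeasure m) S p x :=
  integral_pi_compl_eq S hp x

theorem condC_eq_div {p f : (Fin n → Fin m → ℝ) → ℝ} (hp : Measurable p) (hf : Measurable f)
    (S : Finset (Fin n)) (x : Fin n → Fin m → ℝ) :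
    condC n m p f S x = fiberIntegral (cubeMeasure m) S (fun y => f y * p y) x /
      fiberIntegral (cubeMeasure m) S p x := by
  have hfp : Measurable fun y => f y * p y := hf.mul hp
  simp only [condC, margC_eq_fiberIntegral hp, ← mul_div_assoc, integral_div]
  rw [← integral_pi_compl_eq S hfp]

/-- The coordinates preceding the `k`-th one. -/
def coordsBelow (n k : ℕ) : Finset (Fin n) := Finset.univ.filter fun i : Fin n => (i : ℕ) < k

theorem mem_coordsBelow {n k : ℕ} {i : Fin n} : i ∈ coordsBelow n k ↔ (i : ℕ) < k := by
  simp [coordsBelow]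

/-- The polynomial `Σ_J a_J ℓ_J` with all arguments from the `k`-th on replaced by `b`. -/
noncomputable def frozenSum (b : Fin m → ℝ) (a : (Fin n → Fin (m + 1)) → ℝ) (k : ℕ)
    (x : Fin n → Fin m → ℝ) : ℝ :=
  ∑ J : Fin n → Fin (m + 1), a J * ∏ t, ell m (J t) (if (t : ℕ) < k then x t else b)

theorem continuous_frozenSum (b : Fin m → ℝ) (a : (Fin n → Fin (m + 1)) → ℝ) (k : ℕ) :
    Continuous (frozenSum b a k) := by
  refine continuous_finsetSum _ fun J _ => continuous_const.mul
    (continuous_finsetProd _ fun t _ => (continuous_ell m _).comp ?_)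
  split_ifs
  · exact continuous_apply t
  · exact continuous_const

theorem frozenSum_piecewise (b : Fin m → ℝ) (a : (Fin n → Fin (m + 1)) → ℝ) (k : ℕ)
    (x y : Fin n → Fin m → ℝ) :
    frozenSum b a k ((coordsBelow n k).piecewise x y) = frozenSum b a k x := by
  refine Finset.sum_congr rfl fun J _ => congrArg _ (Finset.prod_congr rfl fun t _ => ?_)
  by_cases ht : (t : ℕ) < k <;> simp [Finset.piecewise, mem_coordsBelow, ht]

theorem frozenSum_full (b : Fin m → ℝ) (a : (Fin n → Fin (m + 1)) → ℝ)
    (x : Fin n → Fin m → ℝ) :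
    frozenSum b a n x = ∑ J : Fin n → Fin (m + 1), a J * ∏ t, ell m (J t) (x t) := by
  simp [frozenSum]

/-- The coefficient of `ℓ_{J_r}(ω^r)` in the `J`-th term, arguments past the `r`-th being `b`. -/
noncomputable def frozenCoeff (b : Fin m → ℝ) (a : (Fin n → Fin (m + 1)) → ℝ) (r : Fin n)
    (J : Fin n → Fin (m + 1)) (x : Fin n → Fin m → ℝ) : ℝ :=
  a J * ∏ t ∈ Finset.univ.erase r, ell m (J t) (if (t : ℕ) < r then x t else b)

theorem frozenSum_eq_sum_coeff (b : Fin m → ℝ) (a : (Fin n → Fin (m + 1)) → ℝ) (r : Fin n)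
    (x : Fin n → Fin m → ℝ) :
    frozenSum b a r x = ∑ J, frozenCoeff b a r J x * ell m (J r) b := by
  refine Finset.sum_congr rfl fun J _ => ?_
  rw [frozenCoeff, mul_assoc, ← Finset.prod_erase_mul _ _ (Finset.mem_univ r)]
  simp

theorem frozenSum_succ_piecewise (b : Fin m → ℝ) (a : (Fin n → Fin (m + 1)) → ℝ) (r : Fin n)
    (x y : Fin n → Fin m → ℝ) :
    frozenSum b a (r + 1) ((coordsBelow n r).piecewise x y) =
      ∑ J, frozenCoeff b a r J x * ell m (J r) (y r) := by
  refine Finset.sum_congr rfl fun J _ => ?_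
  rw [frozenCoeff, mul_assoc, ← Finset.prod_erase_mul _ _ (Finset.mem_univ r)]
  congr 2
  · refine Finset.prod_congr rfl fun t ht => ?_
    have htr : (t : ℕ) ≠ r := fun h => (Finset.ne_of_mem_erase ht) (Fin.ext h)
    by_cases hlt : (t : ℕ) < r
    · simp [Finset.piecewise, mem_coordsBelow, hlt, Nat.lt_succ_of_lt hlt]
    · have hlt' : ¬ (t : ℕ) < r + 1 := by omega
      simp [hlt, hlt']
  · simp [Finset.piecewise, mem_coordsBelow]

variable {b : Fin m → ℝ} {p : (Fin n → Fin m → ℝ) → ℝ}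

theorem LbStable.integral_ell_mul (hstab : LbStable n m b p) (hmeas : Measurable p)
    (hint : Integrable p (Measure.pi fun _ : Fin n => cubeMeasure m))
    (hpos : ∀ᵐ y ∂(Measure.pi fun _ : Fin n => cubeMeasure m), 0 < p y) (r : Fin n) :
    ∀ᵐ x ∂(Measure.pi fun _ : Fin n => cubeMeasure m), ∀ j : Fin (m + 1),
      ∫ y, ell m j (y r) * p ((coordsBelow n r).piecewise x y)
          ∂(Measure.pi fun _ : Fin n => cubeMeasure m) =
        ell m j b * fiberIntegral (cubeMeasure m) (coordsBelow n r) p x := by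
  have hS : Finset.Iio r = coordsBelow n r := by ext i; rw [Finset.mem_Iio, mem_coordsBelow, Fin.lt_def]
  filter_upwards [hstab r, fiberIntegral_pos (coordsBelow n r) hint hpos] with x hx hxpos j
  by_cases hj : (j : ℕ) = 0
  · simp [ell, hj, fiberIntegral]
  · have hxj := hx ⟨(j : ℕ) - 1, by have := j.isLt; omega⟩
    rw [condC_eq_div hmeas (by fun_prop), hS, div_eq_iff hxpos.ne'] at hxj
    have hpw : ∀ y : Fin n → Fin m → ℝ, (coordsBelow n r).piecewise x y r = y r := fun y =>
      Finset.piecewise_eq_of_notMem _ _ _ (by simp [mem_coordsBelow])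
    simpa [ell, hj, fiberIntegral, hpw] using hxj

theorem LbStable.fiberIntegral_frozenSum_succ (hstab : LbStable n m b p) (hmeas : Measurable p)
    (hint : Integrable p (Measure.pi fun _ : Fin n => cubeMeasure m))
    (hpos : ∀ᵐ y ∂(Measure.pi fun _ : Fin n => cubeMeasure m), 0 < p y)
    (a : (Fin n → Fin (m + 1)) → ℝ) (r : Fin n) :
    fiberIntegral (cubeMeasure m) (coordsBelow n r) (fun y => frozenSum b a (r + 1) y * p y)
      =ᵐ[Measure.pi fun _ : Fin n => cubeMeasure m]
    fiberIntegral (cubeMeasure m) (coordsBelow n r) (fun y => frozenSum b a r y * p y) := by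
  filter_upwards [hstab.integral_ell_mul hmeas hint hpos r,
    integrable_comp_piecewise (coordsBelow n r) hint] with x hx hxint
  rw [fiberIntegral_mul_left _ (frozenSum_piecewise b a r)]
  simp only [fiberIntegral, frozenSum_succ_piecewise, Finset.sum_mul, mul_assoc]
  rw [integral_finsetSum]
  · simp only [integral_const_mul, hx, frozenSum_eq_sum_coeff, fiberIntegral, Finset.sum_mul,
      mul_assoc]
  · exact fun J _ => (integrable_continuous_mul
      ((continuous_ell m (J r)).comp (continuous_apply r)) hxint).const_mul _

theorem LbStable.fiberIntegral_frozenSum (hstab : LbStable n m b p) (hmeas : Measurable p)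
    (hint : Integrable p (Measure.pi fun _ : Fin n => cubeMeasure m))
    (hpos : ∀ᵐ y ∂(Measure.pi fun _ : Fin n => cubeMeasure m), 0 < p y)
    (a : (Fin n → Fin (m + 1)) → ℝ) {k r : ℕ} (hkr : k ≤ r) (hrn : r ≤ n) :
    fiberIntegral (cubeMeasure m) (coordsBelow n k) (fun y => frozenSum b a r y * p y)
      =ᵐ[Measure.pi fun _ : Fin n => cubeMeasure m]
    fun x => frozenSum b a k x * fiberIntegral (cubeMeasure m) (coordsBelow n k) p x := by
  induction r, hkr using Nat.le_induction with
  | base => exact .of_forall (fiberIntegral_mul_left _ (frozenSum_piecewise b a k) p)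
  | succ r hkr ih =>
    have hsub : coordsBelow n k ⊆ coordsBelow n r := by
      intro i
      simp only [mem_coordsBelow]
      omega
    have hintegrable (s : ℕ) := integrable_continuous_mul (continuous_frozenSum b a s) hint
    exact (fiberIntegral_fiberIntegral hsub (hintegrable (r + 1))).symm.trans
      ((fiberIntegral_congr_ae _
        (hstab.fiberIntegral_frozenSum_succ hmeas hint hpos a ⟨r, hrn⟩)).trans
      ((fiberIntegral_fiberIntegral hsub (hintegrable r)).trans (ih (Nat.le_of_succ_le hrn))))

end Cube

/-- Jensen lower bound: for `f = h ∘ g` with `h` convex and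
`g = Σ_J a_J ℓ_J` with `a_J ≥ 0` for `J ≠ (0,…,0)`, `f ≥ 0`, every
`(L,b)`-stable positive-a.e. density `p` on `Ω^n` satisfies, a.e.,
`E_p(f | L^1,…,L^k)(ω^1,…,ω^k) ≥ f(ω^1,…,ω^k,b,…,b)`. -/
theorem jensen_lower_bound
    (n m : ℕ) (b : Fin m → ℝ) (hb : ∀ j, b j ∈ Set.Ioo (0 : ℝ) 1)
    (h : ℝ → ℝ) (hconv : ConvexOn ℝ Set.univ h)
    (a : (Fin n → Fin (m + 1)) → ℝ)
    (ha : ∀ J, J ≠ (fun _ => 0) → 0 ≤ a J)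
    (hfnonneg : ∀ y : Fin n → Fin m → ℝ,
      0 ≤ h (∑ J : Fin n → Fin (m + 1), a J * ∏ t, ell m (J t) (y t)))
    (p : (Fin n → Fin m → ℝ) → ℝ)
    (hmeas : Measurable p)
    (hpos : ∀ᵐ y ∂(Measure.pi fun _ : Fin n =>
        volume.restrict (Set.Icc (0 : Fin m → ℝ) 1)), 0 < p y)
    (hone : (∫ y, p y ∂(Measure.pi fun _ : Fin n =>
        volume.restrict (Set.Icc (0 : Fin m → ℝ) 1))) = 1)
    (hstab : LbStable n m b p) :
    ∀ k : ℕ, k ≤ n →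
      ∀ᵐ x ∂(Measure.pi fun _ : Fin n =>
          volume.restrict (Set.Icc (0 : Fin m → ℝ) 1)),
        h (∑ J : Fin n → Fin (m + 1),
            a J * ∏ t, ell m (J t) (if (t : ℕ) < k then x t else b)) ≤
          condC n m p
            (fun y => h (∑ J : Fin n → Fin (m + 1), a J * ∏ t, ell m (J t) (y t)))
            (Finset.univ.filter fun i : Fin n => (i : ℕ) < k) x := by
  intro k hk
  have hint : Integrable p (Measure.pi fun _ : Fin n =>
      volume.restrict (Set.Icc (0 : Fin m → ℝ) 1)) :=
    .of_integral_ne_zero (by rw [hone]; exact one_ne_zero)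
  have hcont : Continuous h := continuousOn_univ.1 (hconv.continuousOn isOpen_univ)
  have hg : Continuous (frozenSum b a n) := continuous_frozenSum b a n
  have hhg : Continuous fun y => h (frozenSum b a n y) := hcont.comp hg
  filter_upwards [hstab.fiberIntegral_frozenSum hmeas hint hpos a hk le_rfl,
    fiberIntegral_pos (coordsBelow n k) hint hpos,
    integrable_comp_piecewise (coordsBelow n k) hint,
    integrable_comp_piecewise (coordsBelow n k) (integrable_continuous_mul hg hint),
    integrable_comp_piecewise (coordsBelow n k) (integrable_continuous_mul hhg hint),
    ae_ae_piecewise _ (coordsBelow n k) hpos] with x hx hxpos hxp hxg hxh hxsec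
  change h (frozenSum b a k x) ≤ condC n m p _ (coordsBelow n k) x
  simp only [← frozenSum_full b]
  rw [condC_eq_div hmeas hhg.measurable, le_div_iff₀ hxpos]
  obtain ⟨c, hc⟩ := hconv.exists_affine_le (frozenSum b a k x)
  set s := frozenSum b a k x
  have hlin := (hxp.const_mul (h s - c * s)).add (hxg.const_mul c)
  have hle := integral_mono_ae hlin hxh (hxsec.mono fun y hy => by
    have hmul := mul_le_mul_of_nonneg_right
      (hc (frozenSum b a n ((coordsBelow n k).piecewise x y))) hy.le
    simp only [Pi.add_apply]
    linarith)
  have hsplit := integral_add (hxp.const_mul (h s - c * s)) (hxg.const_mul c)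
  simp only [Pi.add_apply] at hle
  rw [hsplit, integral_const_mul, integral_const_mul] at hle
  simp only [fiberIntegral] at hx hle ⊢
  rw [hx] at hle
  linarith
end

section
/- The set of risk-neutral measures equals the set of (L,b)-stable measures: in the discrete-time market model with S_i^k = S_i^0 · Ψ_i^1 ⋯ Ψ_i^k, Ψ_i^k = D_i + (U_i−D_i) L_i^k for 1 ≤ i ≤ m, Ψ_0^k = R, and 0 < D_i < R < U_i, a positive-a.e. density p on Ω^n satisfies E_p(S^{k+j} | L^1,...,L^k) = R^j · S^k for all k ≥ 0, j ≥ 1, k+j ≤ n, if and only if E_p(L^{k+1} | L^1,...,L^k) = b for all 0 ≤ k ≤ n−1, where b_i = (R − D_i)/(U_i − D_i). -/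
open MeasureTheory

/-- The price jump of asset `i` (asset `0` is the bond): `Ψ_0 = R`,
`Ψ_i(ω) = D_i + (U_i − D_i) ω_i` for `1 ≤ i ≤ m`. -/
noncomputable def Psi (m : ℕ) (R : ℝ) (D U : Fin m → ℝ)
    (i : Fin (m + 1)) (ω : Fin m → ℝ) : ℝ :=
  if h : (i : ℕ) = 0 then R
  else D ⟨(i : ℕ) - 1, by have := i.isLt; omega⟩ +
    (U ⟨(i : ℕ) - 1, by have := i.isLt; omega⟩ -
      D ⟨(i : ℕ) - 1, by have := i.isLt; omega⟩) *
      ω ⟨(i : ℕ) - 1, by have := i.isLt; omega⟩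

section Averaging

variable {ι E : Type*} [MeasurableSpace E]

/-- The σ-algebra on `ι → E` generated by the coordinates in `S`. -/
abbrev coordSigma (E : Type*) [MeasurableSpace E] (S : Finset ι) : MeasurableSpace (ι → E) :=
  MeasurableSpace.comap (fun x (i : {i // i ∈ S}) => x i) MeasurableSpace.pi

lemma measurable_coordSigma_eval {S : Finset ι} {t : ι} (ht : t ∈ S) :
    Measurable[coordSigma E S] (fun x : ι → E => x t) :=
  (measurable_pi_apply (⟨t, ht⟩ : {i // i ∈ S})).comp
    (comap_measurable fun (x : ι → E) (i : {i // i ∈ S}) => x i)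

lemma coordSigma_le (S : Finset ι) : coordSigma E S ≤ MeasurableSpace.pi :=
  Measurable.comap_le (by fun_prop)

lemma coordSigma_mono {S T : Finset ι} (h : S ⊆ T) : coordSigma E S ≤ coordSigma E T :=
  Measurable.comap_le (@measurable_pi_lambda _ _ _ (coordSigma E T) _ _
    fun i => measurable_coordSigma_eval (h i.2))

/-- Integrating out the coordinates outside `S` is conditioning on the coordinates in `S`. -/
lemma integral_merge_ae_eq_condExp [Fintype ι] [DecidableEq ι] (ν : Measure E)
    [IsProbabilityMeasure ν] (S : Finset ι) {f : (ι → E) → ℝ}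
    (hf : Integrable f (Measure.pi fun _ : ι => ν)) :
    (fun x => ∫ τ : {i : ι // i ∉ S} → E,
        f (fun i => if h : i ∈ S then x i else τ ⟨i, h⟩) ∂(Measure.pi fun _ => ν))
      =ᵐ[Measure.pi fun _ : ι => ν] (Measure.pi fun _ : ι => ν)[f | coordSigma E S] := by
  set e := MeasurableEquiv.piEquivPiSubtypeProd (fun _ : ι => E) (· ∈ S)
  have he : MeasurePreserving e (Measure.pi fun _ => ν)
      ((Measure.pi fun _ => ν).prod (Measure.pi fun _ => ν)) := by
    convert measurePreserving_piEquivPiSubtypeProd (fun _ : ι => ν) (· ∈ S)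
  have hf' := (he.symm e).integrable_comp_of_integrable hf
  set g : ({i // i ∈ S} → E) → ℝ := fun u => ∫ τ, (f ∘ e.symm) (u, τ) ∂(Measure.pi fun _ => ν)
  have hg : Integrable g (Measure.pi fun _ => ν) := hf'.integral_prod_left
  have hr : MeasurePreserving (fun (x : ι → E) (i : {i // i ∈ S}) => x i)
      (Measure.pi fun _ => ν) (Measure.pi fun _ => ν) :=
    measurePreserving_fst.comp he
  change (fun x : ι → E => g fun i => x i) =ᵐ[_] _
  refine ae_eq_condExp_of_forall_setIntegral_eq (coordSigma_le S) hf
    (fun s _ _ => (hr.integrable_comp_of_integrable hg).integrableOn) ?_ ?_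
  · rintro _ ⟨B, hB, rfl⟩ -
    have h₁ : ∫ x in (fun (x : ι → E) (i : {i // i ∈ S}) => x i) ⁻¹' B, g (fun i => x i)
        ∂(Measure.pi fun _ => ν) = ∫ u in B, g u ∂(Measure.pi fun _ => ν) := by
      rw [← hr.map_eq, setIntegral_map hB (hr.map_eq ▸ hg.aestronglyMeasurable)
        hr.measurable.aemeasurable]
    have h₂ := setIntegral_prod (s := B) (t := Set.univ) (f ∘ e.symm) hf'.integrableOn
    have h₃ := he.setIntegral_preimage_emb e.measurableEmbedding (f ∘ e.symm) (B ×ˢ Set.univ)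
    simp only [Measure.restrict_univ, Function.comp_apply, e.symm_apply_apply] at h₂ h₃
    refine h₁.trans (h₂.symm.trans (h₃.symm.trans ?_))
    congr 2
    ext x
    simp [e]
  · exact (hr.map_eq.symm ▸ hg.aestronglyMeasurable).comp_ae_measurable' hr.measurable.aemeasurable

end Averaging

section CondExp

variable {α : Type*} {m m₀ : MeasurableSpace α} {μ : Measure α} [IsFiniteMeasure μ] {p : α → ℝ}

lemma condExp_pos_of_pos (hm : m ≤ m₀) (hp : Integrable p μ) (hpos : ∀ᵐ x ∂μ, 0 < p x) :
    ∀ᵐ x ∂μ, 0 < (μ[p | m]) x := by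
  set s := {x | (μ[p | m]) x ≤ 0}
  have hs : MeasurableSet[m] s :=
    (stronglyMeasurable_condExp (f := p)).measurable measurableSet_Iic
  have hint := setIntegral_condExp hm hp hs
  have hle : ∫ x in s, (μ[p | m]) x ∂μ ≤ 0 := setIntegral_nonpos (hm s hs) fun x hx => hx
  have h0 : p =ᵐ[μ.restrict s] 0 := by
    have hnn : 0 ≤ᵐ[μ.restrict s] p := (ae_restrict_of_ae hpos).mono fun x hx => hx.le
    refine (integral_eq_zero_iff_of_nonneg_ae hnn hp.restrict).1 ?_
    exact le_antisymm (hint ▸ hle) (integral_nonneg_of_ae hnn)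
  filter_upwards [(ae_restrict_iff' (hm s hs)).1 h0, hpos] with x hx hpx
  by_contra hc
  exact hpx.ne' (hx (not_lt.1 hc))

/-- A one-step martingale relation for a discounted process, under the density `p`, iterates. -/
lemma condExp_iterate {F : ℕ → MeasurableSpace α} (hF : ∀ k, F k ≤ m₀) (hmono : Monotone F)
    {W : ℕ → α → ℝ} (hp : Integrable p μ) (hW : ∀ k, StronglyMeasurable[F k] (W k))
    (hWp : ∀ k, Integrable (W k * p) μ) {R : ℝ} {n : ℕ}
    (hstep : ∀ k < n, μ[W (k + 1) * p | F k] =ᵐ[μ] R • (W k * μ[p | F k]))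
    (k j : ℕ) (hkj : k + j ≤ n) :
    μ[W (k + j) * p | F k] =ᵐ[μ] R ^ j • (W k * μ[p | F k]) := by
  have pull (l : ℕ) : μ[W l * p | F l] =ᵐ[μ] W l * μ[p | F l] :=
    condExp_mul_of_stronglyMeasurable_left (hW l) (hWp l) hp
  induction j with
  | zero => simpa using pull k
  | succ j ih =>
    have h₁ : μ[W (k + j + 1) * p | F (k + j)] =ᵐ[μ] R • μ[W (k + j) * p | F (k + j)] :=
      (hstep (k + j) (by omega)).trans ((pull (k + j)).symm.const_smul R)
    calc μ[W (k + j + 1) * p | F k]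
        =ᵐ[μ] μ[μ[W (k + j + 1) * p | F (k + j)] | F k] :=
          (condExp_condExp_of_le (hmono (by omega)) (hF _)).symm
      _ =ᵐ[μ] μ[R • μ[W (k + j) * p | F (k + j)] | F k] := condExp_congr_ae h₁
      _ =ᵐ[μ] R • μ[μ[W (k + j) * p | F (k + j)] | F k] := condExp_smul _ _ _
      _ =ᵐ[μ] R • μ[W (k + j) * p | F k] :=
          (condExp_condExp_of_le (hmono (by omega)) (hF _)).const_smul R
      _ =ᵐ[μ] R • (R ^ j • (W k * μ[p | F k])) := (ih (by omega)).const_smul R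
      _ = R ^ (j + 1) • (W k * μ[p | F k]) := by rw [smul_smul, pow_succ']

end CondExp

section Market

variable {n m : ℕ}

instance isProbabilityMeasure_unitCube :
    IsProbabilityMeasure ((volume : Measure (Fin m → ℝ)).restrict (Set.Icc 0 1)) :=
  ⟨by simp [Real.volume_Icc_pi]⟩

/-- The uniform distribution on `Ω^n`, `Ω = [0,1]^m`. -/
noncomputable abbrev cubeMeasure (n m : ℕ) : Measure (Fin n → Fin m → ℝ) :=
  Measure.pi fun _ => volume.restrict (Set.Icc 0 1)

lemma ae_mem_cube : ∀ᵐ x ∂(cubeMeasure n m), x ∈ Set.Icc 0 1 := by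
  rw [cubeMeasure, ← Measure.restrict_pi_pi]
  refine (ae_restrict_mem (MeasurableSet.univ_pi fun _ => measurableSet_Icc)).mono fun x hx => ?_
  exact ⟨fun t => (hx t trivial).1, fun t => (hx t trivial).2⟩

lemma integrable_continuous_mul_s17 {p f : (Fin n → Fin m → ℝ) → ℝ} (hp : Integrable p (cubeMeasure n m))
    (hf : Continuous f) : Integrable (f * p) (cubeMeasure n m) := by
  obtain ⟨C, hC⟩ :=
    (isCompact_Icc (a := (0 : Fin n → Fin m → ℝ)) (b := 1)).exists_bound_of_continuousOn
      hf.continuousOn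
  exact hp.bdd_mul hf.aestronglyMeasurable (ae_mem_cube.mono hC)

lemma condC_ae_eq {p f : (Fin n → Fin m → ℝ) → ℝ} (hp : Integrable p (cubeMeasure n m))
    (hf : Continuous f) (S : Finset (Fin n)) :
    condC n m p f S =ᵐ[(cubeMeasure n m)] (cubeMeasure n m)[f * p | coordSigma _ S] /
      (cubeMeasure n m)[p | coordSigma _ S] := by
  filter_upwards [integral_merge_ae_eq_condExp _ S (integrable_continuous_mul_s17 hp hf),
    integral_merge_ae_eq_condExp _ S hp] with x h₁ h₂
  simp only [condC, margC, mul_div_assoc', integral_div]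
  exact congrArg₂ _ h₁ h₂

lemma condC_ae_eq_iff {p f g : (Fin n → Fin m → ℝ) → ℝ} (hp : Integrable p (cubeMeasure n m))
    (hpos : ∀ᵐ x ∂(cubeMeasure n m), 0 < p x) (hf : Continuous f) (S : Finset (Fin n)) :
    (∀ᵐ x ∂(cubeMeasure n m), condC n m p f S x = g x) ↔
      (cubeMeasure n m)[f * p | coordSigma _ S] =ᵐ[(cubeMeasure n m)]
        g * (cubeMeasure n m)[p | coordSigma _ S] := by
  have h₁ := condC_ae_eq hp hf S
  have h₂ := condExp_pos_of_pos (coordSigma_le S) hp hpos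
  constructor <;> intro h <;> filter_upwards [h, h₁, h₂] with x hx hx₁ hx₂
  · rw [hx, Pi.div_apply, eq_div_iff hx₂.ne'] at hx₁
    exact hx₁.symm
  · rw [hx₁, Pi.div_apply, hx, Pi.mul_apply, mul_div_cancel_right₀ _ hx₂.ne']

@[simp] lemma Psi_zero (R : ℝ) (D U ω : Fin m → ℝ) : Psi m R D U 0 ω = R := by
  simp [Psi]

@[simp] lemma Psi_succ (R : ℝ) (D U ω : Fin m → ℝ) (i : Fin m) :
    Psi m R D U i.succ ω = D i + (U i - D i) * ω i := by
  simp [Psi]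

lemma continuous_Psi (R : ℝ) (D U : Fin m → ℝ) (i : Fin (m + 1)) :
    Continuous (Psi m R D U i) := by
  refine Fin.cases ?_ (fun i => ?_) i
  · simpa [funext (Psi_zero R D U)] using continuous_const
  · rw [funext fun ω => Psi_succ R D U ω i]
    fun_prop

/-- The price of an asset with initial price `c` and jumps `ψ` after `k` steps. -/
noncomputable def price (n : ℕ) (c : ℝ) (ψ : (Fin m → ℝ) → ℝ) (k : ℕ)
    (x : Fin n → Fin m → ℝ) : ℝ :=
  c * ∏ t ∈ Finset.univ.filter (fun t : Fin n => (t : ℕ) < k), ψ (x t)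

lemma continuous_price (c : ℝ) {ψ : (Fin m → ℝ) → ℝ} (hψ : Continuous ψ) (k : ℕ) :
    Continuous (price n c ψ k) := by
  unfold price
  fun_prop

lemma price_succ (c : ℝ) (ψ : (Fin m → ℝ) → ℝ) {k : ℕ} (hk : k < n) :
    price n c ψ (k + 1) = price n c ψ k * fun x => ψ (x ⟨k, hk⟩) := by
  have : Finset.univ.filter (fun t : Fin n => (t : ℕ) < k + 1) =
      insert ⟨k, hk⟩ (Finset.univ.filter fun t : Fin n => (t : ℕ) < k) := by
    ext t
    simp [Fin.ext_iff]
    omega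
  ext x
  simp only [price, this, Pi.mul_apply]
  rw [Finset.prod_insert (by simp)]
  ring

lemma stronglyMeasurable_price (c : ℝ) {ψ : (Fin m → ℝ) → ℝ} (hψ : Continuous ψ) (k : ℕ) :
    StronglyMeasurable[coordSigma _ (Finset.univ.filter fun t : Fin n => (t : ℕ) < k)]
      (price n c ψ k) := by
  refine Measurable.stronglyMeasurable (Measurable.const_mul ?_ c)
  exact Finset.measurable_prod _ fun t ht => hψ.measurable.comp (measurable_coordSigma_eval ht)

/-- Conditional expectation of the next price under the density `p`. -/
lemma condExp_price_succ {p : (Fin n → Fin m → ℝ) → ℝ} (hp : Integrable p (cubeMeasure n m))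
    (c : ℝ) {ψ : (Fin m → ℝ) → ℝ} (hψ : Continuous ψ) {k : ℕ} (hk : k < n) :
    (cubeMeasure n m)[price n c ψ (k + 1) * p |
        coordSigma _ (Finset.univ.filter fun t : Fin n => (t : ℕ) < k)] =ᵐ[(cubeMeasure n m)]
      price n c ψ k * (cubeMeasure n m)[(fun x => ψ (x ⟨k, hk⟩)) * p |
        coordSigma _ (Finset.univ.filter fun t : Fin n => (t : ℕ) < k)] := by
  rw [price_succ c ψ hk, mul_assoc]
  refine condExp_mul_of_stronglyMeasurable_left (stronglyMeasurable_price c hψ k) ?_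
    (integrable_continuous_mul_s17 hp (by fun_prop))
  rw [← mul_assoc]
  exact integrable_continuous_mul_s17 hp ((continuous_price c hψ k).mul (by fun_prop))

lemma condExp_affine_mul {p : (Fin n → Fin m → ℝ) → ℝ} (hp : Integrable p (cubeMeasure n m))
    (a c : ℝ) {f : (Fin n → Fin m → ℝ) → ℝ} (hf : Continuous f) (S : Finset (Fin n)) :
    (cubeMeasure n m)[(fun x => a + c * f x) * p | coordSigma _ S] =ᵐ[(cubeMeasure n m)]
      a • (cubeMeasure n m)[p | coordSigma _ S] + c • (cubeMeasure n m)[f * p | coordSigma _ S] := by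
  have : (fun x => a + c * f x) * p = a • p + c • (f * p) := by
    ext x
    simp
    ring
  rw [this]
  exact (condExp_add (hp.smul a) ((integrable_continuous_mul_s17 hp hf).smul c) _).trans
    ((condExp_smul _ _ _).add (condExp_smul _ _ _))

end Market

/-- risk-neutral = `(L,b)`-stable.  In the market model
`S_i^k = S_i^0 Ψ_i^1 ⋯ Ψ_i^k`, a positive-a.e. density `p` on `Ω^n` satisfies
`E_p(S^{k+j} | L^1,…,L^k) = R^j S^k` for all admissible `k, j` iff
`E_p(L^{k+1} | L^1,…,L^k) = b`, `b_i = (R − D_i)/(U_i − D_i)`, for all `k`. -/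
theorem risk_neutral_iff_stable
    (n m : ℕ) (R : ℝ) (D U : Fin m → ℝ)
    (hD : ∀ i, 0 < D i) (hDR : ∀ i, D i < R) (hRU : ∀ i, R < U i)
    (S0 : Fin (m + 1) → ℝ) (hS0 : ∀ i, 0 < S0 i)
    (p : (Fin n → Fin m → ℝ) → ℝ)
    (hmeas : Measurable p)
    (hpos : ∀ᵐ y ∂(Measure.pi fun _ : Fin n =>
        volume.restrict (Set.Icc (0 : Fin m → ℝ) 1)), 0 < p y)
    (hone : (∫ y, p y ∂(Measure.pi fun _ : Fin n =>
        volume.restrict (Set.Icc (0 : Fin m → ℝ) 1))) = 1) :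
    (∀ k j : ℕ, 1 ≤ j → k + j ≤ n → ∀ i : Fin (m + 1),
      ∀ᵐ x ∂(Measure.pi fun _ : Fin n =>
          volume.restrict (Set.Icc (0 : Fin m → ℝ) 1)),
        condC n m p
          (fun y => S0 i *
            ∏ t ∈ Finset.univ.filter (fun t : Fin n => (t : ℕ) < k + j),
              Psi m R D U i (y t))
          (Finset.univ.filter fun t : Fin n => (t : ℕ) < k) x =
        R ^ j * (S0 i *
          ∏ t ∈ Finset.univ.filter (fun t : Fin n => (t : ℕ) < k),
            Psi m R D U i (x t))) ↔
    (∀ (k : ℕ) (hk : k < n), ∀ i : Fin m,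
      ∀ᵐ x ∂(Measure.pi fun _ : Fin n =>
          volume.restrict (Set.Icc (0 : Fin m → ℝ) 1)),
        condC n m p (fun y => y ⟨k, hk⟩ i)
          (Finset.univ.filter fun t : Fin n => (t : ℕ) < k) x =
        (R - D i) / (U i - D i)) := by
  have hp : Integrable p (cubeMeasure n m) := .of_integral_ne_zero (by rw [hone]; exact one_ne_zero)
  set F : ℕ → MeasurableSpace (Fin n → Fin m → ℝ) := fun k =>
    coordSigma _ (Finset.univ.filter fun t : Fin n => (t : ℕ) < k) with hFdef
  have hmono : Monotone F := fun k l hkl => coordSigma_mono fun t => by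
    simp only [Finset.mem_filter, Finset.mem_univ, true_and]
    omega
  have hstable (k : ℕ) (hk : k < n) (i : Fin m) := condC_ae_eq_iff hp hpos
    (g := fun _ => (R - D i) / (U i - D i)) (f := fun y => y ⟨k, hk⟩ i) (by fun_prop)
    (Finset.univ.filter fun t : Fin n => (t : ℕ) < k)
  have hneutral (k j : ℕ) (i : Fin (m + 1)) := condC_ae_eq_iff hp hpos
    (g := fun x => R ^ j * price n (S0 i) (Psi m R D U i) k x)
    (continuous_price (S0 i) (continuous_Psi R D U i) (k + j))
    (Finset.univ.filter fun t : Fin n => (t : ℕ) < k)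
  constructor
  · intro h k hk i
    refine (hstable k hk i).2 ?_
    have h₁ := (hneutral k 1 i.succ).1 (h k 1 le_rfl hk i.succ)
    have h₂ := condExp_price_succ hp (S0 i.succ) (continuous_Psi R D U i.succ) hk
    simp only [Psi_succ] at h₂
    have h₃ := condExp_affine_mul hp (D i) (U i - D i) (f := fun y => y ⟨k, hk⟩ i) (by fun_prop)
      (Finset.univ.filter fun t : Fin n => (t : ℕ) < k)
    filter_upwards [h₁, h₂, h₃, ae_mem_cube] with x hx₁ hx₂ hx₃ hx
    have hUD : 0 < U i - D i := by linarith [hDR i, hRU i]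
    have hprice : 0 < price n (S0 i.succ) (Psi m R D U i.succ) k x := by
      refine mul_pos (hS0 _) (Finset.prod_pos fun t _ => ?_)
      rw [Psi_succ]
      exact add_pos_of_pos_of_nonneg (hD i) (mul_nonneg hUD.le (hx.1 t i))
    rw [hx₂, Pi.mul_apply, hx₃, Pi.mul_apply, pow_one, mul_comm R, mul_assoc] at hx₁
    have hx₄ := mul_left_cancel₀ hprice.ne' hx₁
    simp only [Pi.add_apply, Pi.smul_apply, smul_eq_mul] at hx₄
    rw [Pi.mul_apply, div_mul_eq_mul_div, eq_div_iff hUD.ne']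
    linarith
  · intro h k j _ hkj i
    refine (hneutral k j i).2 ?_
    have hψ := continuous_Psi R D U i
    have := condExp_iterate (F := F) (W := price n (S0 i) (Psi m R D U i)) (R := R) (n := n)
      (fun k => coordSigma_le _) hmono hp (stronglyMeasurable_price _ hψ)
      (fun k => integrable_continuous_mul_s17 hp (continuous_price _ hψ k)) ?_ k j hkj
    · filter_upwards [this] with x hx
      rw [hx]
      simp [mul_assoc, hFdef]
    intro k hk
    refine (condExp_price_succ hp _ hψ hk).trans ?_
    suffices hs : (cubeMeasure n m)[(fun x => Psi m R D U i (x ⟨k, hk⟩)) * p | F k] =ᵐ[cubeMeasure n m]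
        R • (cubeMeasure n m)[p | F k] by
      filter_upwards [hs] with x hx
      simp only [Pi.mul_apply, Pi.smul_apply, smul_eq_mul] at hx ⊢
      rw [hx]
      ring
    refine Fin.cases ?_ (fun i => ?_) i
    · simp only [Psi_zero]
      exact condExp_smul R p _
    · simp only [Psi_succ]
      filter_upwards [(hstable k hk i).1 (h k hk i), condExp_affine_mul hp (D i) (U i - D i)
        (f := fun y => y ⟨k, hk⟩ i) (by fun_prop)
        (Finset.univ.filter fun t : Fin n => (t : ℕ) < k)] with x hx hx'
      have hUD : U i - D i ≠ 0 := by linarith [hDR i, hRU i]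
      rw [hx']
      simp only [Pi.add_apply, Pi.smul_apply, smul_eq_mul, hx, Pi.mul_apply, hFdef]
      field_simp
      ring
end
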